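/- For every continuous function f : ℝ → ℝ, (2π)^{−3} ∫_{[0,2π]³} f(8cos θ₁ cos θ₂ cos θ₃) dθ₁dθ₂dθ₃ = ∫_{−8}^{8} f(x) · ( √(1 − x²/64) / (4π²) ) · ₂F₁(1/4, 1/4; 1/2; 1 − x²/64) · ₂F₁(3/4, 3/4; 3/2; 1 − x²/64) dx. (Equivalently, the probability density on (−8,8) of the product (X₁+X₁⁻¹)(X₂+X₂⁻¹)(X₃+X₃⁻¹) of three independent uniform points on the complex unit circle is p̂₃(x) = (√(1−x²/64)/(4π²)) ₂F₁(1/4,1/4;1/2;1−x²/64) ₂F₁(3/4,3/4;3/2;1−x²/64).) -/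

import Mathlib

open MeasureTheory Real

/-- Pochhammer symbol `(x)ₙ = x (x+1) ⋯ (x+n-1)` in `ℝ`. -/
noncomputable def pochR (x : ℝ) (n : ℕ) : ℝ := (ascPochhammer ℝ n).eval x

/-- The Gauss hypergeometric series `₂F₁(a,b;c;z)` over `ℝ`. -/
noncomputable def hyp2F1R (a b c z : ℝ) : ℝ :=
  ∑' n : ℕ, pochR a n * pochR b n / (pochR c n * (n.factorial : ℝ)) * z ^ n

section

open Filter Topology

theorem pochR_zero (x : ℝ) : pochR x 0 = 1 := by simp [pochR]

theorem pochR_succ (x : ℝ) (n : ℕ) : pochR x (n + 1) = pochR x n * (x + n) :=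
  ascPochhammer_succ_eval n x

theorem pochR_pos {x : ℝ} (hx : 0 < x) (n : ℕ) : 0 < pochR x n := ascPochhammer_pos n x hx

theorem pochR_mono {x y : ℝ} (hx : 0 < x) (hxy : x ≤ y) (n : ℕ) : pochR x n ≤ pochR y n := by
  induction n with
  | zero => simp [pochR_zero]
  | succ n ih =>
    rw [pochR_succ, pochR_succ]
    have := pochR_pos (hx.trans_le hxy) n
    gcongr

theorem pochR_one (n : ℕ) : pochR 1 n = n.factorial := by
  simp [pochR]

/-- `π * wallisBeta n m` is the integral of `cos ^ (2 * n) * sin ^ (2 * m)` over `[0, π]`. -/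
noncomputable def wallisBeta (n m : ℕ) : ℝ :=
  pochR (1 / 2) n * pochR (1 / 2) m / (n + m).factorial

theorem wallisBeta_succ_right (n m : ℕ) :
    wallisBeta n (m + 1) = (m + 1 / 2) / (n + m + 1) * wallisBeta n m := by
  have h : ((n + m).factorial : ℝ) ≠ 0 := by positivity
  rw [wallisBeta, wallisBeta, pochR_succ, ← add_assoc, Nat.factorial_succ]
  push_cast
  field_simp
  ring

theorem wallisBeta_succ_left (n m : ℕ) :
    wallisBeta (n + 1) m = (n + 1 / 2) / (n + m + 1) * wallisBeta n m := by
  have h : ((n + m).factorial : ℝ) ≠ 0 := by positivity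
  rw [wallisBeta, wallisBeta, pochR_succ, add_right_comm, Nat.factorial_succ]
  push_cast
  field_simp
  ring

theorem wallisBeta_pos (n m : ℕ) : 0 < wallisBeta n m := by
  have h1 := pochR_pos (x := 1 / 2) (by norm_num) n
  have h2 := pochR_pos (x := 1 / 2) (by norm_num) m
  rw [wallisBeta]
  positivity

theorem wallisBeta_le (n m : ℕ) : wallisBeta n m ≤ n.factorial / (m + 1) ^ n := by
  have h1 : pochR (1 / 2) n ≤ n.factorial :=
    pochR_one n ▸ pochR_mono (by norm_num) (by norm_num) n
  have h2 : pochR (1 / 2) m ≤ m.factorial :=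
    pochR_one m ▸ pochR_mono (by norm_num) (by norm_num) m
  have h3 : ((m.factorial : ℝ)) * (m + 1) ^ n ≤ (n + m).factorial := by
    rw [add_comm n m]
    exact_mod_cast Nat.factorial_mul_pow_le_factorial
  have h4 := (pochR_pos (x := 1 / 2) (by norm_num) m).le
  rw [wallisBeta, div_le_div_iff₀ (by positivity) (by positivity), mul_assoc]
  calc pochR (1 / 2) n * (pochR (1 / 2) m * (m + 1) ^ n)
      ≤ n.factorial * (m.factorial * (m + 1) ^ n) := by gcongr
    _ ≤ _ := by gcongr

theorem sum_range_mul_wallisBeta (n N : ℕ) :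
    ∑ m ∈ Finset.range N, ((m : ℝ) + 1) * wallisBeta (n + 2) (m + 1) =
      wallisBeta n 1 - wallisBeta n (N + 1) - N * wallisBeta (n + 1) (N + 1) := by
  induction N with
  | zero => simp
  | succ N ih =>
    rw [Finset.sum_range_succ, ih]
    simp only [wallisBeta_succ_right, wallisBeta_succ_left]
    push_cast
    field_simp
    ring

theorem tendsto_wallisBeta_one_div :
    Tendsto (fun n : ℕ => wallisBeta n 1 / wallisBeta n 0 ^ 3) atTop (𝓝 (π / 2)) := by
  have hW : ∀ n : ℕ, wallisBeta n 0 ^ 2 * (2 * n + 1) * Wallis.W n = 1 := by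
    intro n
    induction n with
    | zero => simp [wallisBeta, pochR_zero, Wallis.W]
    | succ n ih =>
      rw [Wallis.W_succ, wallisBeta_succ_left]
      push_cast
      field_simp
      linear_combination (2 * (n : ℝ) + 3) * (n + 1) ^ 2 * ih
  have hlim : Tendsto (fun n : ℕ => Wallis.W n * (1 - 1 / (2 * ((n : ℝ) + 1)))) atTop
      (𝓝 (π / 2 * (1 - 0))) := by
    refine Wallis.tendsto_W_nhds_pi_div_two.mul (tendsto_const_nhds.sub ?_)
    refine ((tendsto_one_div_add_atTop_nhds_zero_nat (𝕜 := ℝ)).const_mul (1 / 2)).congr'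
      (Eventually.of_forall fun n => ?_) |>.trans (by simp)
    field_simp
  rw [sub_zero, mul_one] at hlim
  refine hlim.congr fun n => ?_
  have h0 := wallisBeta_pos n 0
  rw [wallisBeta_succ_right, eq_div_iff (by positivity)]
  have := hW n
  push_cast
  field_simp
  linear_combination ((n : ℝ) + 1) * this

theorem tendsto_wallisBeta_one_div_shift :
    Tendsto (fun n : ℕ => wallisBeta n 1 / wallisBeta (n + 2) 0 ^ 3) atTop (𝓝 (π / 2)) := by
  have h0 := tendsto_one_div_add_atTop_nhds_zero_nat (𝕜 := ℝ)
  have h1 : Tendsto (fun n : ℕ => (1 - 1 / 2 * (1 / ((n : ℝ) + 1)))) atTop (𝓝 1) := by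
    simpa using (h0.const_mul (1 / 2 : ℝ)).const_sub (1 : ℝ)
  have h2 := h1.comp (tendsto_add_atTop_nat 1)
  have h3 := tendsto_wallisBeta_one_div.div ((h1.mul h2).pow 3) (by norm_num)
  rw [one_mul, one_pow, div_one] at h3
  refine h3.congr fun n => ?_
  have hpos := wallisBeta_pos n 0
  have e1 : 1 - 1 / 2 * (1 / ((n : ℝ) + 1)) = (n + 1 / 2) / (n + 1) := by field_simp; ring
  have e2 : 1 - 1 / 2 * (1 / ((n : ℝ) + 1 + 1)) = (n + 3 / 2) / (n + 2) := by
    field_simp; ring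
  simp only [Function.comp_apply, Pi.div_apply, wallisBeta_succ_left, wallisBeta_succ_right]
  push_cast
  rw [e1, e2]
  field_simp
  ring

/-- Solutions of the recurrence satisfied by the coefficients of the density. -/
structure IsDensityCoeff (g : ℕ → ℝ) : Prop where
  nonneg : ∀ m, 0 ≤ g m
  le : ∀ m, g m ≤ m + 1
  zero : g 0 = 1
  one : 2 * g 1 = g 0
  recurrence : ∀ m : ℕ, (m + 5 / 2) * (m + 3 / 2) * (m + 2) * g (m + 2) =
      (m + 3 / 2) * (2 * (m + 3 / 2) ^ 2 + 1 / 4) * g (m + 1) - (m + 1) ^ 3 * g m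

namespace IsDensityCoeff

theorem sum_telescope {g : ℕ → ℝ} (hg : IsDensityCoeff g) (n N : ℕ) :
    ∑ m ∈ Finset.range (N + 1), g m * ((n + 1) ^ 3 * wallisBeta (n + 1) (m + 1) -
      (n + 1 / 2) ^ 3 * wallisBeta n (m + 1)) =
    (N + 3 / 2) * (N + 1 / 2) * (N + 1) * g (N + 1) * wallisBeta (n + 1) N -
      (N + 1) ^ 3 * g N * wallisBeta (n + 1) (N + 1) := by
  induction N with
  | zero =>
    simp only [zero_add, Finset.sum_range_one, ← hg.one, wallisBeta_succ_right,
      wallisBeta_succ_left]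
    push_cast
    field_simp
    ring
  | succ N ih =>
    rw [Finset.sum_range_succ, ih]
    have := hg.recurrence N
    have h2 : g (N + 1 + 1) = ((N + 3 / 2) * (2 * (N + 3 / 2) ^ 2 + 1 / 4) * g (N + 1)
      - (N + 1) ^ 3 * g N) / ((N + 5 / 2) * (N + 3 / 2) * (N + 2)) := by
      rw [← this]; field_simp
    rw [h2]
    simp only [wallisBeta_succ_right, wallisBeta_succ_left]
    push_cast
    field_simp
    ring

theorem summable {g : ℕ → ℝ} (hg : IsDensityCoeff g) (n : ℕ) :
    Summable fun m => g m * wallisBeta (n + 2) (m + 1) := by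
  refine summable_of_sum_range_le (c := wallisBeta n 1)
    (fun m => mul_nonneg (hg.nonneg m) (wallisBeta_pos _ _).le) fun N => ?_
  have h := sum_range_mul_wallisBeta n N
  have h1 := wallisBeta_pos n (N + 1)
  have h2 := mul_nonneg N.cast_nonneg (wallisBeta_pos (n + 1) (N + 1)).le
  calc _ ≤ ∑ m ∈ Finset.range N, ((m : ℝ) + 1) * wallisBeta (n + 2) (m + 1) := by
        gcongr with m; exacts [(wallisBeta_pos _ _).le, hg.le m]
    _ ≤ _ := by linarith

theorem tsum_le {g : ℕ → ℝ} (hg : IsDensityCoeff g) (n : ℕ) :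
    ∑' m, g m * wallisBeta (n + 2) (m + 1) ≤ wallisBeta n 1 := by
  refine Summable.tsum_le_of_sum_range_le (hg.summable n) fun N => ?_
  have h := sum_range_mul_wallisBeta n N
  have h1 := wallisBeta_pos n (N + 1)
  have h2 := mul_nonneg N.cast_nonneg (wallisBeta_pos (n + 1) (N + 1)).le
  calc _ ≤ ∑ m ∈ Finset.range N, ((m : ℝ) + 1) * wallisBeta (n + 2) (m + 1) := by
        gcongr with m; exacts [(wallisBeta_pos _ _).le, hg.le m]
    _ ≤ _ := by linarith

theorem le_tsum {g : ℕ → ℝ} (hg : IsDensityCoeff g) (n : ℕ) :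
    wallisBeta (n + 2) 1 ≤ ∑' m, g m * wallisBeta (n + 2) (m + 1) := by
  have := (hg.summable n).le_tsum 0
    (fun m _ => mul_nonneg (hg.nonneg m) (wallisBeta_pos _ _).le)
  simpa [hg.zero] using this

theorem tsum_succ {g : ℕ → ℝ} (hg : IsDensityCoeff g) (n : ℕ) :
    ((n : ℝ) + 5) ^ 3 * ∑' m, g m * wallisBeta (n + 5) (m + 1) =
      (n + 9 / 2) ^ 3 * ∑' m, g m * wallisBeta (n + 4) (m + 1) := by
  have h1 := (((hg.summable (n + 3)).hasSum.mul_left (((n : ℝ) + 5) ^ 3)).sub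
    ((hg.summable (n + 2)).hasSum.mul_left (((n : ℝ) + 9 / 2) ^ 3))).tendsto_sum_nat
  have h2 := h1.comp (tendsto_add_atTop_nat 1)
  have h3 : Tendsto (fun N : ℕ => ((N : ℝ) + 3 / 2) * (N + 1 / 2) * (N + 1) * g (N + 1) *
      wallisBeta (n + 5) N - (N + 1) ^ 3 * g N * wallisBeta (n + 5) (N + 1)) atTop (𝓝 0) := by
    have hlim : Tendsto (fun N : ℕ => ((n + 5).factorial : ℝ) * 4 * (1 / ((N : ℝ) + 1))) atTop
        (𝓝 0) := by
      simpa using (tendsto_one_div_add_atTop_nhds_zero_nat (𝕜 := ℝ)).const_mul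
        (((n + 5).factorial : ℝ) * 4)
    have hb : ∀ N : ℕ, wallisBeta (n + 5) N ≤ (n + 5).factorial / ((N : ℝ) + 1) ^ 5 := by
      intro N
      refine (wallisBeta_le _ _).trans ?_
      gcongr
      · simp
      · omega
    refine squeeze_zero_norm (fun N => ?_) hlim
    have hN : (0 : ℝ) ≤ N := N.cast_nonneg
    have hg0 := hg.nonneg
    have hw0 := fun n m => (wallisBeta_pos n m).le
    have hg1 := hg.le (N + 1)
    push_cast at hg1
    have hb1 := hb (N + 1)
    push_cast at hb1
    refine abs_sub_le_of_nonneg_of_le ?_ ?_ ?_ ?_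
    · have := hg0 (N + 1)
      have := hw0 (n + 5) N
      positivity
    · calc ((N : ℝ) + 3 / 2) * (N + 1 / 2) * (N + 1) * g (N + 1) * wallisBeta (n + 5) N
          ≤ ((N : ℝ) + 1) ^ 2 * (N + 1) * (2 * (N + 1)) *
              ((n + 5).factorial / ((N : ℝ) + 1) ^ 5) := by
            gcongr
            · exact hw0 _ _
            · exact hg0 _
            · nlinarith
            · linarith
            · exact hb N
        _ = (n + 5).factorial * 2 * (1 / ((N : ℝ) + 1)) := by field_simp
        _ ≤ _ := by gcongr; norm_num
    · have := hg0 N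
      have := hw0 (n + 5) (N + 1)
      positivity
    · calc ((N : ℝ) + 1) ^ 3 * g N * wallisBeta (n + 5) (N + 1)
          ≤ ((N : ℝ) + 1) ^ 3 * (N + 1) * ((n + 5).factorial / ((N : ℝ) + 1) ^ 5) := by
            gcongr
            · exact hw0 _ _
            · exact hg.le N
            · refine hb1.trans ?_
              gcongr
              linarith
        _ = (n + 5).factorial * 1 * (1 / ((N : ℝ) + 1)) := by field_simp
        _ ≤ _ := by gcongr; norm_num
  have h4 := tendsto_nhds_unique (h2.congr fun N => ?_) h3
  · linarith
  · have := hg.sum_telescope (n + 4) N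
    push_cast at this
    simp only [Function.comp_apply]
    rw [show n + 5 = n + 4 + 1 from rfl, ← this]
    refine Finset.sum_congr rfl fun m _ => ?_
    rw [show n + 3 + 2 = n + 4 + 1 from rfl, show n + 2 + 2 = n + 4 from rfl]
    ring

theorem hasSum {g : ℕ → ℝ} (hg : IsDensityCoeff g) (n : ℕ) :
    HasSum (fun m => g m * wallisBeta (n + 4) (m + 1)) (π / 2 * wallisBeta (n + 4) 0 ^ 3) := by
  have hpos : ∀ n, 0 < wallisBeta n 0 := fun n => wallisBeta_pos n 0
  have hc : ∀ n, (∑' m, g m * wallisBeta (n + 4) (m + 1)) / wallisBeta (n + 4) 0 ^ 3 =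
      (∑' m, g m * wallisBeta 4 (m + 1)) / wallisBeta 4 0 ^ 3 := by
    intro n
    induction n with
    | zero => simp
    | succ n ih =>
      have h1 := hpos (n + 4)
      rw [← ih, show n + 1 + 4 = n + 4 + 1 by ring, wallisBeta_succ_left,
        div_eq_div_iff (by positivity) (by positivity)]
      have := hg.tsum_succ n
      rw [show n + 5 = n + 4 + 1 from rfl] at this
      push_cast
      field_simp
      linear_combination 8 * this
  set c := (∑' m, g m * wallisBeta 4 (m + 1)) / wallisBeta 4 0 ^ 3
  have h1 : π / 2 ≤ c := by
    refine le_of_tendsto (tendsto_wallisBeta_one_div.comp (tendsto_add_atTop_nat 4))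
      (Eventually.of_forall fun n => ?_)
    have := hpos (n + 4)
    rw [← hc n, Function.comp_apply]
    gcongr
    exact hg.le_tsum (n + 2)
  have h2 : c ≤ π / 2 := by
    refine ge_of_tendsto (tendsto_wallisBeta_one_div_shift.comp (tendsto_add_atTop_nat 2))
      (Eventually.of_forall fun n => ?_)
    have := hpos (n + 4)
    rw [← hc n, Function.comp_apply]
    gcongr
    exact hg.tsum_le (n + 2)
  have h3 := hc n
  rw [le_antisymm h2 h1, div_eq_iff (by have := hpos (n + 4); positivity)] at h3
  rw [← h3]
  exact (hg.summable (n + 2)).hasSum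

end IsDensityCoeff

section

open PowerSeries

/-- The Cauchy product of the coefficients of two hypergeometric series, whose equations share the
same symmetric square up to a factor `z ^ (1 / 2)`, satisfies the recurrence of that symmetric
square. -/
theorem cauchyProduct_recurrence {a b : ℕ → ℝ}
    (ha : ∀ j : ℕ, (j + 1) * (j + 1 / 2) * a (j + 1) = (j + 1 / 4) ^ 2 * a j)
    (hb : ∀ j : ℕ, (j + 1) * (j + 3 / 2) * b (j + 1) = (j + 3 / 4) ^ 2 * b j) (g : ℕ → ℝ)
    (hg : ∀ m, g m = ∑ ij ∈ Finset.HasAntidiagonal.antidiagonal m, a ij.1 * b ij.2) :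
    2 * g 1 = g 0 ∧
    ∀ m : ℕ, (m + 5 / 2) * (m + 3 / 2) * (m + 2) * g (m + 2) =
      (m + 3 / 2) * (2 * (m + 3 / 2) ^ 2 + 1 / 4) * g (m + 1) - (m + 1) ^ 3 * g m := by
  set P : ℝ⟦X⟧ := PowerSeries.mk a with hP
  set Q : ℝ⟦X⟧ := PowerSeries.mk b with hQ
  obtain ⟨θ, hθ, hmul, hX⟩ : ∃ θ : ℝ⟦X⟧ →ₗ[ℝ] ℝ⟦X⟧, (∀ F n, coeff n (θ F) = n * coeff n F) ∧
      (∀ F G, θ (F * G) = θ F * G + F * θ G) ∧ θ X = X := by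
    refine ⟨LinearMap.mulLeft ℝ X ∘ₗ (d⁄dX ℝ : Derivation ℝ ℝ⟦X⟧ ℝ⟦X⟧).toLinearMap, ?_, ?_, ?_⟩
    · intro F n
      cases n with
      | zero => simp
      | succ n => simp [coeff_succ_X_mul, PowerSeries.coeff_derivative]; ring
    · intro F G
      simp [Derivation.leibniz]; ring
    · simp
  have hC : ∀ (c : ℝ) F, θ (C c * F) = C c * θ F := by
    intro c F
    ext n
    simp [hθ]; ring
  have e1 : C 16 * θ (θ P) - C 8 * θ P = X * (C 16 * θ (θ P) + C 8 * θ P + P) := by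
    ext n
    cases n with
    | zero =>
      simp only [map_sub, coeff_C_mul, coeff_zero_X_mul, hθ]
      simp
    | succ n =>
      simp only [map_sub, map_add, coeff_C_mul, coeff_succ_X_mul, hθ, hP, coeff_mk]
      push_cast
      linear_combination 16 * ha n
  have e2 : C 16 * θ (θ Q) + C 8 * θ Q = X * (C 16 * θ (θ Q) + C 24 * θ Q + C 9 * Q) := by
    ext n
    cases n with
    | zero =>
      simp only [map_add, coeff_C_mul, coeff_zero_X_mul, hθ]
      simp
    | succ n =>
      simp only [map_add, coeff_C_mul, coeff_succ_X_mul, hθ, hQ, coeff_mk]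
      push_cast
      linear_combination 16 * hb n
  have e1' := congrArg θ e1
  have e2' := congrArg θ e2
  simp only [map_sub, map_add, hC, hmul, hX] at e1' e2'
  have hR : C 8 * θ (P * Q) - C 32 * θ (θ (θ (P * Q)))
      + X * (C 64 * θ (θ (θ (P * Q))) + C 96 * θ (θ (P * Q)) + C 56 * θ (P * Q) + C 12 * (P * Q))
      - X * (X * (C 32 * θ (θ (θ (P * Q))) + C 96 * θ (θ (P * Q)) + C 96 * θ (P * Q)
        + C 32 * (P * Q))) = 0 := by
    simp only [map_add, hmul]
    simp only [map_ofNat] at e1 e2 e1' e2' ⊢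
    linear_combination (-2 * (1 - X) * Q) * e1' + (-2 * (1 - X) * P) * e2' +
      (-6 * (1 - X) * θ Q + (3 * X - 1) * Q) * e1 + (-6 * (1 - X) * θ P + (1 + X) * P) * e2
  have hco : ∀ m, coeff m (P * Q) = g m := by
    intro m
    simp [coeff_mul, hg, hP, hQ]
  constructor
  · have := congrArg (coeff 1) hR
    rw [show (1 : ℕ) = 0 + 1 from rfl] at this
    simp only [map_sub, map_add, coeff_C_mul, coeff_succ_X_mul, hθ, hco, coeff_zero_X_mul,
      map_zero] at this
    push_cast at this
    norm_num at this
    linarith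
  · intro m
    have := congrArg (coeff (m + 1 + 1)) hR
    simp only [map_sub, map_add, coeff_C_mul, coeff_succ_X_mul, hθ, hco, map_zero] at this
    push_cast at this
    rw [show m + 1 + 1 = m + 2 from rfl] at this
    linear_combination (-1 / 32) * this

end

/-- Coefficients of the Gauss hypergeometric series. -/
noncomputable def hypCoeff (a b c : ℝ) (n : ℕ) : ℝ :=
  pochR a n * pochR b n / (pochR c n * (n.factorial : ℝ))

theorem hypCoeff_zero (a b c : ℝ) : hypCoeff a b c 0 = 1 := by simp [hypCoeff, pochR_zero]

theorem hypCoeff_succ {a b c : ℝ} (hc : 0 < c) (n : ℕ) :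
    (n + 1) * (n + c) * hypCoeff a b c (n + 1) = (n + a) * (n + b) * hypCoeff a b c n := by
  have h := (pochR_pos hc n).ne'
  have h1 : c + n ≠ 0 := by positivity
  have h2 : ((n.factorial : ℕ) : ℝ) ≠ 0 := by positivity
  simp only [hypCoeff, pochR_succ, Nat.factorial_succ]
  push_cast
  field_simp
  ring

theorem hypCoeff_nonneg {a b c : ℝ} (ha : 0 < a) (hb : 0 < b) (hc : 0 < c) (n : ℕ) :
    0 ≤ hypCoeff a b c n := by
  have h1 := pochR_pos ha n
  have h2 := pochR_pos hb n
  have h3 := pochR_pos hc n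
  rw [hypCoeff]
  positivity

theorem hypCoeff_le_one {a b c : ℝ} (ha : 0 < a) (hb : 0 < b) (hac : a ≤ c) (hb1 : b ≤ 1)
    (n : ℕ) : hypCoeff a b c n ≤ 1 := by
  have h1 := pochR_pos (ha.trans_le hac) n
  have h2 := pochR_mono ha hac n
  have h3 := pochR_one n ▸ pochR_mono hb hb1 n
  have h4 := pochR_pos hb n
  rw [hypCoeff, div_le_one (by positivity)]
  gcongr

theorem summable_norm_hypCoeff {a b c : ℝ} (ha : 0 < a) (hb : 0 < b) (hac : a ≤ c)
    (hb1 : b ≤ 1) {z : ℝ} (hz0 : 0 ≤ z) (hz1 : z < 1) :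
    Summable fun n => ‖hypCoeff a b c n * z ^ n‖ := by
  refine Summable.of_nonneg_of_le (fun n => norm_nonneg _) (fun n => ?_)
    (summable_geometric_of_lt_one hz0 hz1)
  have h := hypCoeff_nonneg ha hb (ha.trans_le hac) n
  rw [Real.norm_of_nonneg (by positivity)]
  exact mul_le_of_le_one_left (by positivity) (hypCoeff_le_one ha hb hac hb1 n)

/-- Power series coefficients of
`₂F₁(1/4, 1/4; 1/2; z) * ₂F₁(3/4, 3/4; 3/2; z)`. -/
noncomputable def densityCoeff (m : ℕ) : ℝ :=
  ∑ ij ∈ Finset.HasAntidiagonal.antidiagonal m,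
    hypCoeff (1 / 4) (1 / 4) (1 / 2) ij.1 * hypCoeff (3 / 4) (3 / 4) (3 / 2) ij.2

theorem isDensityCoeff_densityCoeff : IsDensityCoeff densityCoeff := by
  have h := cauchyProduct_recurrence (a := hypCoeff (1 / 4) (1 / 4) (1 / 2))
    (b := hypCoeff (3 / 4) (3 / 4) (3 / 2))
    (fun j => by rw [hypCoeff_succ (by norm_num)]; ring)
    (fun j => by rw [hypCoeff_succ (by norm_num)]; ring) densityCoeff (fun m => rfl)
  have ha := hypCoeff_nonneg (a := 1 / 4) (b := 1 / 4) (c := 1 / 2) (by norm_num) (by norm_num)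
    (by norm_num)
  have hb := hypCoeff_nonneg (a := 3 / 4) (b := 3 / 4) (c := 3 / 2) (by norm_num) (by norm_num)
    (by norm_num)
  refine ⟨fun m => Finset.sum_nonneg fun ij _ => mul_nonneg (ha _) (hb _), fun m => ?_, ?_,
    h.1, h.2⟩
  · calc densityCoeff m ≤ ∑ ij ∈ Finset.HasAntidiagonal.antidiagonal m, (1 : ℝ) :=
          Finset.sum_le_sum fun ij _ => mul_le_one₀
            (hypCoeff_le_one (by norm_num) (by norm_num) (by norm_num) (by norm_num) _) (hb _)
            (hypCoeff_le_one (by norm_num) (by norm_num) (by norm_num) (by norm_num) _)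
      _ = m + 1 := by simp
  · simp [densityCoeff, hypCoeff_zero]

theorem hasSum_densityCoeff {z : ℝ} (hz0 : 0 ≤ z) (hz1 : z < 1) :
    HasSum (fun m => densityCoeff m * z ^ m)
      (hyp2F1R (1 / 4) (1 / 4) (1 / 2) z * hyp2F1R (3 / 4) (3 / 4) (3 / 2) z) := by
  have h1 := summable_norm_hypCoeff (a := 1 / 4) (b := 1 / 4) (c := 1 / 2) (by norm_num)
    (by norm_num) (by norm_num) (by norm_num) hz0 hz1
  have h2 := summable_norm_hypCoeff (a := 3 / 4) (b := 3 / 4) (c := 3 / 2) (by norm_num)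
    (by norm_num) (by norm_num) (by norm_num) hz0 hz1
  have h3 := (summable_norm_sum_mul_antidiagonal_of_summable_norm h1 h2).of_norm.hasSum
  rw [← tsum_mul_tsum_eq_tsum_sum_antidiagonal_of_summable_norm h1 h2] at h3
  refine h3.congr_fun ?_
  intro m
  rw [densityCoeff, Finset.sum_mul]
  refine Finset.sum_congr rfl fun ij hij => ?_
  rw [← Finset.HasAntidiagonal.mem_antidiagonal.mp hij, pow_add]
  ring

theorem integral_cos_pow_mul_sin_pow (n m : ℕ) :
    ∫ x in (0 : ℝ)..π, cos x ^ (2 * n) * sin x ^ (2 * m) = π * wallisBeta n m := by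
  induction m generalizing n with
  | zero =>
    simp only [mul_zero, pow_zero, mul_one]
    induction n with
    | zero => simp [wallisBeta, pochR_zero]
    | succ n ih =>
      rw [show 2 * (n + 1) = 2 * n + 2 by ring, integral_cos_pow, ih, wallisBeta_succ_left]
      simp
      field_simp
  | succ m ih =>
    have h : ∀ x : ℝ, cos x ^ (2 * n) * sin x ^ (2 * (m + 1)) =
        cos x ^ (2 * n) * sin x ^ (2 * m) - cos x ^ (2 * (n + 1)) * sin x ^ (2 * m) := by
      intro x
      have := sin_sq x
      rw [show 2 * (m + 1) = 2 * m + 2 by ring, show 2 * (n + 1) = 2 * n + 2 by ring, pow_add,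
        pow_add, this]
      ring
    simp_rw [h]
    rw [intervalIntegral.integral_sub (by apply Continuous.intervalIntegrable; fun_prop)
      (by apply Continuous.intervalIntegrable; fun_prop), ih, ih, wallisBeta_succ_right,
      wallisBeta_succ_left]
    field_simp
    ring

theorem integral_cos_pow_even_period (n : ℕ) :
    ∫ x in (0 : ℝ)..(2 * π), cos x ^ (2 * n) = 2 * π * wallisBeta n 0 := by
  induction n with
  | zero => simp [wallisBeta, pochR_zero]
  | succ n ih =>
    rw [show 2 * (n + 1) = 2 * n + 2 by ring, integral_cos_pow, ih, wallisBeta_succ_left]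
    simp
    field_simp

theorem integral_cos_pow_odd_period (n : ℕ) :
    ∫ x in (0 : ℝ)..(2 * π), cos x ^ (2 * n + 1) = 0 := by
  induction n with
  | zero => simp
  | succ n ih =>
    rw [show 2 * (n + 1) + 1 = 2 * n + 1 + 2 by ring, integral_cos_pow, ih]
    simp

/-- Two finite measures on `[-1, 1]` with the same moments agree. -/
theorem measure_eq_of_moments_eq {μ ν : Measure ℝ} [IsFiniteMeasure μ] [IsFiniteMeasure ν]
    (hμ : ∀ᵐ x ∂μ, x ∈ Set.Icc (-1 : ℝ) 1) (hν : ∀ᵐ x ∂ν, x ∈ Set.Icc (-1 : ℝ) 1)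
    (h : ∀ j : ℕ, ∫ x, x ^ j ∂μ = ∫ x, x ^ j ∂ν) : μ = ν := by
  have key : ∀ (ρ : Measure ℝ) [IsFiniteMeasure ρ], (∀ᵐ x ∂ρ, x ∈ Set.Icc (-1 : ℝ) 1) →
      ∀ f : ℝ → ℝ, Continuous f → Integrable f ρ := by
    intro ρ _ hρ f hf
    obtain ⟨C, hC⟩ := (isCompact_Icc (a := (-1 : ℝ)) (b := 1)).exists_bound_of_continuousOn
      hf.continuousOn
    exact Integrable.of_bound hf.aestronglyMeasurable C (hρ.mono fun x hx => hC x hx)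
  have hpoly : ∀ p : Polynomial ℝ, ∫ x, p.eval x ∂μ = ∫ x, p.eval x ∂ν := by
    intro p
    simp_rw [Polynomial.eval_eq_sum_range]
    rw [integral_finsetSum _ fun i _ => key μ hμ _ (by fun_prop),
      integral_finsetSum _ fun i _ => key ν hν _ (by fun_prop)]
    simp_rw [integral_const_mul, h]
  refine ext_of_forall_integral_eq_of_IsFiniteMeasure fun f => ?_
  have hclose : ∀ (ρ : Measure ℝ) [IsFiniteMeasure ρ], (∀ᵐ x ∂ρ, x ∈ Set.Icc (-1 : ℝ) 1) →
      ∀ (ε : ℝ) (p : Polynomial ℝ), (∀ x ∈ Set.Icc (-1 : ℝ) 1, |p.eval x - f x| < ε) →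
      |∫ x, p.eval x ∂ρ - ∫ x, f x ∂ρ| ≤ ε * ρ.real Set.univ := by
    intro ρ _ hρ ε p hp
    rw [← integral_sub (key ρ hρ _ p.continuous) (key ρ hρ _ f.continuous)]
    exact norm_integral_le_of_norm_le_const (f := fun x => p.eval x - f x)
      (hρ.mono fun x hx => (hp x hx).le)
  refine eq_of_abs_sub_le_all fun ε hε => ?_
  set M := μ.real Set.univ + ν.real Set.univ + 1
  have hμ0 : 0 ≤ μ.real Set.univ := measureReal_nonneg
  have hν0 : 0 ≤ ν.real Set.univ := measureReal_nonneg
  have hM : 0 < M := by positivity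
  obtain ⟨p, hp⟩ := exists_polynomial_near_of_continuousOn (-1) 1 f f.continuous.continuousOn
    (ε / M) (by positivity)
  have h1 := hclose μ hμ _ p hp
  have h2 := hclose ν hν _ p hp
  rw [hpoly] at h1
  have h3 : ε / M * M = ε := by field_simp
  have h4 : 0 < ε / M := by positivity
  calc |∫ x, f x ∂μ - ∫ x, f x ∂ν|
      ≤ |∫ x, f x ∂μ - ∫ x, p.eval x ∂ν| + |∫ x, p.eval x ∂ν - ∫ x, f x ∂ν| :=
        abs_sub_le _ _ _
    _ ≤ ε / M * μ.real Set.univ + ε / M * ν.real Set.univ := by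
        rw [abs_sub_comm]; gcongr
    _ ≤ ε / M * M := by simp only [M]; nlinarith
    _ = ε := h3

/-- Measures on `[-1, 1] \ {0}` with the same moments of order at least `2 * k` agree, even
when one of them is not assumed to be finite. -/
theorem measure_eq_of_high_moments_eq {μ ν : Measure ℝ} (k : ℕ)
    (hμ : ∀ᵐ x ∂μ, x ∈ Set.Icc (-1 : ℝ) 1) (hν : ∀ᵐ x ∂ν, x ∈ Set.Icc (-1 : ℝ) 1)
    (hμ0 : ∀ᵐ x ∂μ, x ≠ 0) (hν0 : ∀ᵐ x ∂ν, x ≠ 0)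
    (hμk : ∫⁻ x, ENNReal.ofReal (x ^ (2 * k)) ∂μ ≠ ⊤)
    (hνk : ∫⁻ x, ENNReal.ofReal (x ^ (2 * k)) ∂ν ≠ ⊤)
    (h : ∀ j : ℕ, ∫ x, x ^ (j + 2 * k) ∂μ = ∫ x, x ^ (j + 2 * k) ∂ν) : μ = ν := by
  set w : ℝ → ENNReal := fun x => ENNReal.ofReal (x ^ (2 * k)) with hw
  have hwm : Measurable w := by fun_prop
  have hinv : ∀ ρ : Measure ℝ, (∀ᵐ x ∂ρ, x ≠ 0) → (ρ.withDensity w).withDensity w⁻¹ = ρ := by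
    intro ρ hρ
    refine withDensity_inv_same hwm (hρ.mono fun x hx => ?_) (by simp [hw])
    have : 0 < x ^ (2 * k) := (even_two_mul k).pow_pos hx
    simpa [hw] using this
  have hmom : ∀ (ρ : Measure ℝ) (j : ℕ),
      ∫ x, x ^ j ∂(ρ.withDensity w) = ∫ x, x ^ (j + 2 * k) ∂ρ := by
    intro ρ j
    rw [integral_withDensity_eq_integral_toReal_smul hwm (by simp [hw])]
    refine integral_congr_ae (Eventually.of_forall fun x => ?_)
    simp only [hw, smul_eq_mul]
    rw [ENNReal.toReal_ofReal ((even_two_mul k).pow_nonneg x), pow_add, mul_comm]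
  have : IsFiniteMeasure (μ.withDensity w) := isFiniteMeasure_withDensity hμk
  have : IsFiniteMeasure (ν.withDensity w) := isFiniteMeasure_withDensity hνk
  rw [← hinv μ hμ0, ← hinv ν hν0, measure_eq_of_moments_eq
    (withDensity_absolutelyContinuous _ _ hμ) (withDensity_absolutelyContinuous _ _ hν)
    (fun j => by rw [hmom, hmom, h])]

/-- The distribution of `cos θ₀ * cos θ₁ * cos θ₂` for independent uniform angles. -/
noncomputable def cosProdMeasure : Measure ℝ :=
  ENNReal.ofReal ((2 * π) ^ 3)⁻¹ •
    ((volume : Measure (Fin 3 → ℝ)).restrict (Set.univ.pi fun _ => Set.Icc 0 (2 * π))).map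
      fun θ => cos (θ 0) * cos (θ 1) * cos (θ 2)

theorem integral_cosProdMeasure {h : ℝ → ℝ} (hh : Continuous h) :
    ∫ x, h x ∂cosProdMeasure = ((2 * π) ^ 3)⁻¹ *
      ∫ θ : Fin 3 → ℝ in Set.univ.pi fun _ => Set.Icc 0 (2 * π),
        h (cos (θ 0) * cos (θ 1) * cos (θ 2)) := by
  rw [cosProdMeasure, integral_smul_measure, integral_map
    (Continuous.aemeasurable (by fun_prop)) hh.aestronglyMeasurable,
    ENNReal.toReal_ofReal (by positivity), smul_eq_mul]

instance : IsFiniteMeasure cosProdMeasure := by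
  have : IsFiniteMeasure ((volume : Measure (Fin 3 → ℝ)).restrict
      (Set.univ.pi fun _ => Set.Icc 0 (2 * π))) :=
    ⟨by
      rw [Measure.restrict_apply_univ]
      exact (isCompact_univ_pi fun _ => isCompact_Icc).measure_lt_top⟩
  exact Measure.smul_finite _ ENNReal.ofReal_ne_top

theorem ae_cosProdMeasure_mem : ∀ᵐ x ∂cosProdMeasure, x ∈ Set.Icc (-1 : ℝ) 1 := by
  refine Measure.ae_smul_measure ?_ _
  refine (ae_map_iff (p := fun x => x ∈ Set.Icc (-1 : ℝ) 1)
    (Continuous.aemeasurable (by fun_prop)) measurableSet_Icc).mpr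
    (Eventually.of_forall fun θ => ?_)
  rw [Set.mem_Icc, ← abs_le, abs_mul, abs_mul]
  exact mul_le_one₀ (mul_le_one₀ (abs_cos_le_one _) (abs_nonneg _) (abs_cos_le_one _))
    (abs_nonneg _) (abs_cos_le_one _)

theorem ae_cos_ne_zero : ∀ᵐ x : ℝ, cos x ≠ 0 := by
  have : {x : ℝ | cos x = 0} ⊆ Set.range fun k : ℤ => (2 * k + 1) * π / 2 := by
    intro x hx
    obtain ⟨k, hk⟩ := cos_eq_zero_iff.mp hx
    exact ⟨k, hk.symm⟩
  have h := ((Set.countable_range _).mono this).ae_notMem (volume : Measure ℝ)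
  exact h

theorem ae_cosProdMeasure_ne_zero : ∀ᵐ x ∂cosProdMeasure, x ≠ 0 := by
  refine Measure.ae_smul_measure ?_ _
  refine (ae_map_iff (p := fun x : ℝ => x ≠ 0) (Continuous.aemeasurable (by fun_prop))
    (measurableSet_singleton (0 : ℝ)).compl).mpr (ae_restrict_of_ae ?_)
  have h : ∀ i : Fin 3, ∀ᵐ θ : Fin 3 → ℝ, cos (θ i) ≠ 0 := fun i =>
    (Measure.quasiMeasurePreserving_eval (fun _ : Fin 3 => (volume : Measure ℝ)) i).ae
      ae_cos_ne_zero
  filter_upwards [h 0, h 1, h 2] with θ h0 h1 h2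
  exact mul_ne_zero (mul_ne_zero h0 h1) h2

theorem integral_pow_cosProdMeasure (j : ℕ) :
    ∫ x, x ^ j ∂cosProdMeasure = ((2 * π)⁻¹ * ∫ x in (0 : ℝ)..(2 * π), cos x ^ j) ^ 3 := by
  rw [integral_cosProdMeasure (by fun_prop), volume_pi, Measure.restrict_pi_pi]
  have := integral_fintype_prod_eq_pow (ι := Fin 3) (fun x : ℝ => cos x ^ j)
    (μ := volume.restrict (Set.Icc 0 (2 * π)))
  simp only [Fin.prod_univ_three, Fintype.card_fin] at this
  simp_rw [mul_pow]
  rw [this, integral_Icc_eq_integral_Ioc,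
    ← intervalIntegral.integral_of_le (by positivity)]
  rw [inv_pow, mul_pow]

/-- The density of the angle `φ` for which `cos φ` is distributed as `cosProdMeasure`. -/
noncomputable def angleDensity (φ : ℝ) : ENNReal :=
  ∑' m, ENNReal.ofReal (2 / π ^ 2 * densityCoeff m * sin φ ^ (2 * (m + 1)))

theorem measurable_angleDensity : Measurable angleDensity :=
  Measurable.tsum fun m => by fun_prop

theorem angleDensity_pi_sub (φ : ℝ) : angleDensity (π - φ) = angleDensity φ := by
  simp [angleDensity]

theorem angleDensity_eq {φ : ℝ} (hφ : cos φ ≠ 0) :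
    angleDensity φ = ENNReal.ofReal (2 / π ^ 2 * sin φ ^ 2 *
      (hyp2F1R (1 / 4) (1 / 4) (1 / 2) (sin φ ^ 2) *
        hyp2F1R (3 / 4) (3 / 4) (3 / 2) (sin φ ^ 2))) ∧
    0 ≤ hyp2F1R (1 / 4) (1 / 4) (1 / 2) (sin φ ^ 2) *
        hyp2F1R (3 / 4) (3 / 4) (3 / 2) (sin φ ^ 2) := by
  have hlt : sin φ ^ 2 < 1 := by
    rw [sin_sq]
    have : 0 < cos φ ^ 2 := by positivity
    linarith
  have h := hasSum_densityCoeff (sq_nonneg (sin φ)) hlt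
  have hg := isDensityCoeff_densityCoeff.nonneg
  refine ⟨?_, h.nonneg fun m => by have := hg m; positivity⟩
  have h2 := h.mul_left (2 / π ^ 2 * sin φ ^ 2)
  rw [← h2.tsum_eq, ENNReal.ofReal_tsum_of_nonneg _ h2.summable, angleDensity]
  · congr! 3 with m
    rw [← pow_mul]
    ring
  · intro m
    have := hg m
    positivity

/-- The distribution of `cos φ` when `φ` has density `angleDensity` on `(0, π)`. -/
noncomputable def hypMeasure : Measure ℝ :=
  ((volume.restrict (Set.Ioo 0 π)).withDensity angleDensity).map cos

theorem integral_hypMeasure {h : ℝ → ℝ} (hh : Continuous h) :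
    ∫ x, h x ∂hypMeasure = ∫ φ in Set.Ioo 0 π, (angleDensity φ).toReal * h (cos φ) := by
  rw [hypMeasure, integral_map (by fun_prop) hh.aestronglyMeasurable,
    integral_withDensity_eq_integral_toReal_smul measurable_angleDensity]
  · rfl
  · refine ae_restrict_of_ae (ae_cos_ne_zero.mono fun φ hφ => ?_)
    rw [(angleDensity_eq hφ).1]
    exact ENNReal.ofReal_lt_top

theorem ae_hypMeasure_mem : ∀ᵐ x ∂hypMeasure, x ∈ Set.Icc (-1 : ℝ) 1 := by
  exact (ae_map_iff (p := fun x => x ∈ Set.Icc (-1 : ℝ) 1) (by fun_prop)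
    measurableSet_Icc).mpr (Eventually.of_forall fun φ => cos_mem_Icc φ)

theorem ae_hypMeasure_ne_zero : ∀ᵐ x ∂hypMeasure, x ≠ 0 := by
  exact (ae_map_iff (p := fun x : ℝ => x ≠ 0) (by fun_prop)
    (measurableSet_singleton (0 : ℝ)).compl).mpr
    (withDensity_absolutelyContinuous _ _ (ae_restrict_of_ae ae_cos_ne_zero))

theorem lintegral_pow_hypMeasure (n : ℕ) :
    ∫⁻ x, ENNReal.ofReal (x ^ (2 * (n + 4))) ∂hypMeasure =
      ENNReal.ofReal (wallisBeta (n + 4) 0 ^ 3) := by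
  have hg := isDensityCoeff_densityCoeff
  have hsum := (hg.hasSum n).mul_left (2 / π)
  have e : 2 / π * (π / 2 * wallisBeta (n + 4) 0 ^ 3) = wallisBeta (n + 4) 0 ^ 3 := by
    field_simp
  rw [e] at hsum
  rw [hypMeasure, lintegral_map (by fun_prop) (by fun_prop),
    lintegral_withDensity_eq_lintegral_mul _ measurable_angleDensity (by fun_prop),
    ← hsum.tsum_eq, ENNReal.ofReal_tsum_of_nonneg _ hsum.summable]
  · simp only [Pi.mul_apply, angleDensity, ← ENNReal.tsum_mul_right]
    rw [lintegral_tsum fun m => by fun_prop]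
    congr! 2 with m
    have hm := hg.nonneg m
    have hpow : ∀ x : ℝ, 0 ≤ x ^ (2 * (n + 4)) := fun x => (even_two_mul _).pow_nonneg x
    have hpow' : ∀ x : ℝ, 0 ≤ x ^ (2 * (m + 1)) := fun x => (even_two_mul _).pow_nonneg x
    have h1 : ∀ φ : ℝ, ENNReal.ofReal (2 / π ^ 2 * densityCoeff m * sin φ ^ (2 * (m + 1))) *
        ENNReal.ofReal (cos φ ^ (2 * (n + 4))) = ENNReal.ofReal (2 / π ^ 2 * densityCoeff m *
          (cos φ ^ (2 * (n + 4)) * sin φ ^ (2 * (m + 1)))) := by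
      intro φ
      have := hpow' (sin φ)
      rw [← ENNReal.ofReal_mul (by positivity)]
      congr 1
      ring
    simp_rw [h1]
    rw [← ofReal_integral_eq_lintegral_ofReal, integral_const_mul,
      ← integral_Ioc_eq_integral_Ioo, ← intervalIntegral.integral_of_le pi_pos.le,
      integral_cos_pow_mul_sin_pow]
    · congr 1
      field_simp
    · refine (Continuous.integrableOn_Icc (a := 0) (b := π) (by fun_prop)).mono_set
        Set.Ioo_subset_Icc_self
    · refine Eventually.of_forall fun φ => ?_
      have := hpow (cos φ)
      have := hpow' (sin φ)
      positivity
  · intro m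
    have := hg.nonneg m
    have := wallisBeta_pos (n + 4) (m + 1)
    positivity

theorem integral_pow_odd_hypMeasure (n : ℕ) : ∫ x, x ^ (2 * n + 1) ∂hypMeasure = 0 := by
  rw [integral_hypMeasure (by fun_prop), ← integral_Ioc_eq_integral_Ioo,
    ← intervalIntegral.integral_of_le pi_pos.le]
  have h := intervalIntegral.integral_comp_sub_left (a := 0) (b := π)
    (fun φ => (angleDensity φ).toReal * cos φ ^ (2 * n + 1)) π
  simp only [angleDensity_pi_sub, cos_pi_sub, sub_self, sub_zero,
    (odd_two_mul_add_one n).neg_pow, mul_neg, intervalIntegral.integral_neg] at h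
  linarith

theorem cosProdMeasure_eq_hypMeasure : cosProdMeasure = hypMeasure := by
  refine measure_eq_of_high_moments_eq 4 ae_cosProdMeasure_mem ae_hypMeasure_mem
    ae_cosProdMeasure_ne_zero ae_hypMeasure_ne_zero ?_ ?_ fun j => ?_
  · refine ((lintegral_mono_ae (ae_cosProdMeasure_mem.mono fun x hx =>
      (?_ : ENNReal.ofReal (x ^ (2 * 4)) ≤ 1))).trans_lt ?_).ne
    · rw [ENNReal.ofReal_le_one, pow_mul]
      exact pow_le_one₀ (sq_nonneg x) (by rw [sq_le_one_iff_abs_le_one, abs_le]; exact hx)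
    · simp
  · rw [lintegral_pow_hypMeasure 0]
    exact ENNReal.ofReal_ne_top
  · rw [integral_pow_cosProdMeasure]
    obtain ⟨i, rfl | rfl⟩ := j.even_or_odd'
    · rw [← mul_add, integral_cos_pow_even_period, integral_eq_lintegral_of_nonneg_ae
        (Eventually.of_forall fun x => (even_two_mul _).pow_nonneg x)
        (Continuous.aestronglyMeasurable (by fun_prop)), lintegral_pow_hypMeasure,
        ENNReal.toReal_ofReal (by have := wallisBeta_pos (i + 4) 0; positivity)]
      congr 1
      field_simp
    · rw [show 2 * i + 1 + 2 * 4 = 2 * (i + 4) + 1 by ring, integral_cos_pow_odd_period,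
        integral_pow_odd_hypMeasure]
      simp

theorem image_eight_mul_cos : (fun φ => 8 * cos φ) '' Set.Ioo 0 π = Set.Ioo (-8) 8 := by
  have h : cos '' Set.Ioo 0 π = Set.Ioo (-1) 1 :=
    cosPartialHomeomorph.toPartialEquiv.image_source_eq_target
  rw [← Set.image_image (fun x => 8 * x) cos, h, Set.image_mul_left_Ioo (by norm_num)]
  norm_num

end

/-- The density of `(X₁+X₁⁻¹)(X₂+X₂⁻¹)(X₃+X₃⁻¹)` for three independent uniform
points on the unit circle is
`p̂₃(x) = (√(1−x²/64)/(4π²)) ₂F₁(1/4,1/4;1/2;1−x²/64) ₂F₁(3/4,3/4;3/2;1−x²/64)`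
on `(−8,8)`: for every continuous `f`,
`(2π)⁻³ ∫_{[0,2π]³} f(8 cos θ₁ cos θ₂ cos θ₃) = ∫_{−8}^8 f(x) p̂₃(x) dx`. -/
theorem stmt17 (f : ℝ → ℝ) (hf : Continuous f) :
    ((2 * π) ^ 3)⁻¹ *
        (∫ θ : Fin 3 → ℝ in Set.univ.pi fun _ => Set.Icc 0 (2 * π),
          f (8 * Real.cos (θ 0) * Real.cos (θ 1) * Real.cos (θ 2))) =
      ∫ x in (-8 : ℝ)..8,
        f x * (Real.sqrt (1 - x ^ 2 / 64) / (4 * π ^ 2) *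
          hyp2F1R (1/4) (1/4) (1/2) (1 - x ^ 2 / 64) *
          hyp2F1R (3/4) (3/4) (3/2) (1 - x ^ 2 / 64)) := by
  have h1 := integral_cosProdMeasure (h := fun x => f (8 * x)) (by fun_prop)
  rw [cosProdMeasure_eq_hypMeasure, integral_hypMeasure (by fun_prop)] at h1
  simp only [← mul_assoc (8 : ℝ)] at h1
  rw [← h1, intervalIntegral.integral_of_le (by norm_num), integral_Ioc_eq_integral_Ioo,
    ← image_eight_mul_cos, integral_image_eq_integral_abs_deriv_smul measurableSet_Ioo
      (f' := fun φ => 8 * -sin φ)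
      (fun φ _ => ((hasDerivAt_cos φ).const_mul 8).hasDerivWithinAt)
      (fun x hx y hy hxy => injOn_cos (Set.Ioo_subset_Icc_self hx) (Set.Ioo_subset_Icc_self hy)
        (by simpa using hxy))]
  refine integral_congr_ae ?_
  filter_upwards [ae_restrict_mem measurableSet_Ioo, ae_restrict_of_ae ae_cos_ne_zero]
    with φ hφ hcos
  have hsin : 0 < sin φ := sin_pos_of_mem_Ioo hφ
  have e1 : 1 - (8 * cos φ) ^ 2 / 64 = sin φ ^ 2 := by rw [sin_sq]; ring
  obtain ⟨h2, h3⟩ := angleDensity_eq hcos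
  rw [h2, ENNReal.toReal_ofReal (by positivity), e1, sqrt_sq hsin.le, smul_eq_mul, mul_neg,
    abs_neg, abs_of_pos (by positivity)]
  ring
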